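/- Let G and H be primitive graphs and P : E_G × E_H → ℤ a payoff function. Then the limit V(G,H,P) = lim_{n→∞} (1/n)·V_n(G,H,P) exists and is a rational number. -/

import Mathlib

open Filter Set

structure DirGraph (V E : Type) where
  src : E → V
  tgt : E → V

namespace DirGraph

variable {V E : Type}

/-- A (finite) walk: consecutive edges are compatible. -/
def IsWalkList (G : DirGraph V E) (p : List E) : Prop :=
  p.Chain' fun e f => G.tgt e = G.src f

/-- The set of walks of length `n`. -/
def walks (G : DirGraph V E) (n : ℕ) : Set (List E) :=
  {p | p.length = n ∧ G.IsWalkList p}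

/-- The set of walks of length `n` from `v` to `w`. -/
def walksFT (G : DirGraph V E) (n : ℕ) (v w : V) : Set (List E) :=
  {p | p.length = n ∧ G.IsWalkList p ∧
    ∃ h : p ≠ [], G.src (p.head h) = v ∧ G.tgt (p.getLast h) = w}

def IsCycle (G : DirGraph V E) (p : List E) : Prop :=
  G.IsWalkList p ∧ ∃ h : p ≠ [], G.src (p.head h) = G.tgt (p.getLast h)

def Irreducible (G : DirGraph V E) : Prop :=
  ∀ v w : V, ∃ n : ℕ, (G.walksFT n v w).Nonempty

/-- Irreducible and the gcd of all cycle lengths is 1 (every common divisor of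
the cycle lengths equals 1). -/
def Primitive (G : DirGraph V E) : Prop :=
  G.Irreducible ∧ ∀ d : ℕ, (∀ p, G.IsCycle p → d ∣ p.length) → d = 1

end DirGraph

/-- `Σ_i P(q_i, p_i)`. -/
def payoffSum {EG EH : Type} (P : EG → EH → ℤ) (q : List EG) (p : List EH) : ℤ :=
  (List.zipWith P q p).sum

/-- `V_n(G,H,P) = max_{p ∈ W_n(H)} min_{q ∈ W_n(G)} Σ P(q_i,p_i)`. -/
noncomputable def Vn {VG EG VH EH : Type} (G : DirGraph VG EG) (H : DirGraph VH EH)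
    (P : EG → EH → ℤ) (n : ℕ) : ℤ :=
  sSup ((fun p => sInf ((fun q => payoffSum P q p) '' G.walks n)) '' H.walks n)

/-- `M(p)(v,w) = inf {Σ P(q_i,p_i) : q ∈ W_n(G, v → w)}`, with `inf ∅ = ⊤`. -/
noncomputable def Mfun {VG EG EH : Type} (G : DirGraph VG EG) (P : EG → EH → ℤ)
    (p : List EH) : VG → VG → WithTop ℤ :=
  fun v w => sInf ((fun q => ((payoffSum P q p : ℤ) : WithTop ℤ)) '' G.walksFT p.length v w)

/-- `f < g` pointwise everywhere. -/
def StrictDom {V α : Type} [LT α] (f g : V → V → α) : Prop := ∀ v w, f v w < g v w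

/-- `<`-maximal elements of a set w.r.t. a strict domination relation. -/
def maxElems {α : Type} (lt : α → α → Prop) (A : Set α) : Set α :=
  {f ∈ A | ¬ ∃ g ∈ A, lt f g}

/-- Tropical convolution on `(ℤ ∪ {∞})`-valued matrices. -/
noncomputable def tconv {V : Type} (f g : V → V → WithTop ℤ) : V → V → WithTop ℤ :=
  fun u w => sInf (Set.range fun v => f u v + g v w)

/-- Tropical convolution on `ℤ`-valued matrices. -/
noncomputable def tconvZ {V : Type} (f g : V → V → ℤ) : V → V → ℤ :=
  fun u w => sInf (Set.range fun v => f u v + g v w)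

/-- Non-improvable walks in `H` (of any length). -/
noncomputable def walksDagger {VG EG VH EH : Type} (G : DirGraph VG EG) (H : DirGraph VH EH)
    (P : EG → EH → ℤ) : Set (List EH) :=
  {p | ∃ u v : VH, p ∈ H.walksFT p.length u v ∧
    Mfun G P p ∈ maxElems StrictDom (Mfun G P '' H.walksFT p.length u v)}

/-- The edge shift of a graph. -/
def XEdge {V E : Type} (G : DirGraph V E) : Set (ℤ → E) :=
  {x | ∀ n : ℤ, G.tgt (x n) = G.src (x (n + 1))}

/-- The word `x_{[m,n]}` as a list (of length `n - m + 1` when `m ≤ n`). -/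
def seg {A : Type} (x : ℤ → A) (m n : ℤ) : List A :=
  List.ofFn fun i : Fin (n + 1 - m).toNat => x (m + i)

/-- `X_H^†`: points all of whose subwords are non-improvable walks. -/
noncomputable def XHdag {VG EG VH EH : Type} (G : DirGraph VG EG) (H : DirGraph VH EH)
    (P : EG → EH → ℤ) : Set (ℤ → EH) :=
  {x | x ∈ XEdge H ∧ ∀ m n : ℤ, m ≤ n → seg x m n ∈ walksDagger G H P}

/-- `R(p)`: optimal responses to `p`. -/
noncomputable def Rset {VG EG EH : Type} (G : DirGraph VG EG) (P : EG → EH → ℤ)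
    (p : List EH) : Set (List EG) :=
  {q | ∃ v w : VG, q ∈ G.walksFT p.length v w ∧
    ((payoffSum P q p : ℤ) : WithTop ℤ) = Mfun G P p v w}

namespace DirGraph

variable {V E : Type} {G : DirGraph V E}

theorem isWalkList_iff {p : List E} :
    G.IsWalkList p ↔ p.IsChain fun e f => G.tgt e = G.src f := Iff.rfl

theorem append_mem_walksFT {m n : ℕ} {u v w : V} {p q : List E}
    (hp : p ∈ G.walksFT m u v) (hq : q ∈ G.walksFT n v w) :
    p ++ q ∈ G.walksFT (m + n) u w := by
  obtain ⟨hpl, hpw, hp0, hps, hpt⟩ := hp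
  obtain ⟨hql, hqw, hq0, hqs, hqt⟩ := hq
  refine ⟨by simp [hpl, hql], ?_, by simp [hp0], ?_, ?_⟩
  · rw [isWalkList_iff] at *
    refine hpw.append hqw fun x hx y hy => ?_
    rw [List.getLast?_eq_some_getLast hp0, Option.mem_some_iff] at hx
    rw [List.head?_eq_some_head hq0, Option.mem_some_iff] at hy
    rw [← hx, ← hy, hpt, hqs]
  · rw [List.head_append_of_ne_nil hp0, hps]
  · rw [List.getLast_append_of_ne_nil _ hq0, hqt]

theorem Primitive.nonempty (hG : G.Primitive) : Nonempty V := by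
  by_contra h
  rw [not_nonempty_iff] at h
  have := hG.2 0 fun p hp => by
    obtain ⟨_, h0, _⟩ := hp
    exact (h.false (G.src (p.head h0))).elim
  omega

theorem Primitive.exists_src_eq (hG : G.Primitive) (v : V) : ∃ e, G.src e = v := by
  obtain ⟨n, p, -, -, h0, hs, -⟩ := hG.1 v v
  exact ⟨_, hs⟩

theorem Primitive.setGcd_closedWalk_lengths (hG : G.Primitive) (v : V) :
    Nat.setGcd {n | (G.walksFT n v v).Nonempty} = 1 := by
  refine hG.2 _ fun p hp => ?_
  obtain ⟨hpw, h0, hp⟩ := hp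
  obtain ⟨a, q, hq⟩ := hG.1 v (G.src (p.head h0))
  obtain ⟨b, r, hr⟩ := hG.1 (G.src (p.head h0)) v
  have hpc : p ∈ G.walksFT p.length (G.src (p.head h0)) (G.src (p.head h0)) :=
    ⟨rfl, hpw, h0, rfl, hp.symm⟩
  have h1 := Nat.setGcd_dvd_of_mem (s := {n | (G.walksFT n v v).Nonempty})
    ⟨_, append_mem_walksFT hq hr⟩
  have h2 := Nat.setGcd_dvd_of_mem (s := {n | (G.walksFT n v v).Nonempty})
    ⟨_, append_mem_walksFT hq (append_mem_walksFT hpc hr)⟩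
  have h3 : a + (p.length + b) = p.length + (a + b) := by ring
  rw [h3] at h2
  exact (Nat.dvd_add_left h1).1 h2

theorem Primitive.exists_walksFT_nonempty [Finite V] (hG : G.Primitive) :
    ∃ k, ∀ v w, (G.walksFT k v w).Nonempty := by
  have := Fintype.ofFinite V
  obtain ⟨o⟩ := hG.nonempty
  obtain ⟨N, hN⟩ := Nat.exists_mem_closure_of_ge {n | (G.walksFT n o o).Nonempty}
  rw [hG.setGcd_closedWalk_lengths] at hN
  have hclosed : ∀ m ∈ AddSubmonoid.closure {n | (G.walksFT n o o).Nonempty},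
      m = 0 ∨ (G.walksFT m o o).Nonempty := by
    intro m hm
    induction hm using AddSubmonoid.closure_induction with
    | mem x hx => exact Or.inr hx
    | zero => exact Or.inl rfl
    | add x y _ _ hx hy =>
      rcases hx with rfl | ⟨p, hp⟩
      · simpa using hy
      · rcases hy with rfl | ⟨q, hq⟩
        · exact Or.inr ⟨p, hp⟩
        · exact Or.inr ⟨_, append_mem_walksFT hp hq⟩
  choose a p hp using fun v => hG.1 v o
  choose b q hq using fun w => hG.1 o w
  refine ⟨N + 1 + ∑ v, a v + ∑ w, b w, fun v w => ?_⟩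
  have ha : a v ≤ ∑ v, a v := Finset.single_le_sum (fun _ _ => Nat.zero_le _) (Finset.mem_univ v)
  have hb : b w ≤ ∑ w, b w := Finset.single_le_sum (fun _ _ => Nat.zero_le _) (Finset.mem_univ w)
  obtain ⟨m, hm⟩ : ∃ m, N + 1 + ∑ v, a v + ∑ w, b w = a v + (m + b w) :=
    ⟨N + 1 + ∑ v, a v + ∑ w, b w - a v - b w, by omega⟩
  rcases hclosed m (hN m (by omega) (one_dvd m)) with h0 | ⟨c, hc⟩
  · omega
  · rw [hm]
    exact ⟨_, append_mem_walksFT (hp v) (append_mem_walksFT hc (hq w))⟩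

theorem exists_walk_from (hG : ∀ v, ∃ e, G.src e = v) (n : ℕ) (v : V) :
    ∃ p ∈ G.walks n, ∀ e ∈ p.head?, G.src e = v := by
  induction n generalizing v with
  | zero => exact ⟨[], ⟨rfl, List.isChain_nil⟩, by simp⟩
  | succ n ih =>
    obtain ⟨e, rfl⟩ := hG v
    obtain ⟨p, ⟨hl, hw⟩, hp⟩ := ih (G.tgt e)
    refine ⟨e :: p, ⟨by simp [hl], ?_⟩, by simp⟩
    exact List.isChain_cons.2 ⟨fun f hf => (hp f hf).symm, hw⟩

theorem finite_walks [Finite E] (n : ℕ) : (G.walks n).Finite :=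
  (List.finite_length_eq E n).subset fun _ h => h.1

/-- A cyclic block in front of a walk may be repeated arbitrarily often. -/
theorem isWalkList_iterate_append {y z : List E} (hyz : G.IsWalkList (y ++ z))
    (hhead : (y ++ z).head? = z.head?) (m : ℕ) :
    G.IsWalkList ((y ++ ·)^[m] z) ∧ ((y ++ ·)^[m] z).head? = z.head? := by
  induction m with
  | zero => exact ⟨List.IsChain.right_of_append hyz, rfl⟩
  | succ m ih =>
    rw [Function.iterate_succ_apply']
    obtain ⟨hy, -, hj⟩ := List.isChain_append.1 (isWalkList_iff.1 hyz)
    refine ⟨List.isChain_append.2 ⟨hy, ih.1, ?_⟩, ?_⟩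
    · rwa [ih.2]
    · rw [List.head?_append, ih.2, ← List.head?_append, hhead]

end DirGraph

section MinPayoff

open DirGraph

variable {VG EG EH : Type} (G : DirGraph VG EG) (P : EG → EH → ℤ)

/-- The least payoff against `p` among the walks of `G` starting at a given vertex. -/
noncomputable def minPayoff : List EH → VG → ℤ
  | [], _ => 0
  | e :: p, v => sInf ((fun g => P g e + minPayoff p (G.tgt g)) '' {g | G.src g = v})

variable {G P}

theorem minPayoff_cons_le [Finite EG] (e : EH) (p : List EH) (g : EG) :
    minPayoff G P (e :: p) (G.src g) ≤ P g e + minPayoff G P p (G.tgt g) :=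
  csInf_le (toFinite _).bddBelow ⟨g, rfl, rfl⟩

theorem exists_minPayoff_cons_eq [Finite EG] (hG : ∀ v, ∃ g, G.src g = v) (e : EH)
    (p : List EH) (v : VG) :
    ∃ g, G.src g = v ∧ minPayoff G P (e :: p) v = P g e + minPayoff G P p (G.tgt g) := by
  obtain ⟨g, hg, h⟩ := Set.Nonempty.csInf_mem
    (s := (fun g => P g e + minPayoff G P p (G.tgt g)) '' {g | G.src g = v})
    (Set.Nonempty.image _ (hG v)) (toFinite _)
  exact ⟨g, hg, h.symm⟩

theorem minPayoff_append_eq_add [Finite EG] (hG : ∀ v, ∃ g, G.src g = v) {p p' : List EH} {c : ℤ}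
    (h : ∀ v, minPayoff G P p v = minPayoff G P p' v + c) (u : List EH) (v : VG) :
    minPayoff G P (u ++ p) v = minPayoff G P (u ++ p') v + c := by
  induction u generalizing v with
  | nil => exact h v
  | cons e u ih =>
    rw [List.cons_append, List.cons_append]
    apply le_antisymm
    · obtain ⟨g, rfl, hg⟩ := exists_minPayoff_cons_eq (P := P) hG e (u ++ p') v
      have := minPayoff_cons_le (G := G) (P := P) e (u ++ p) g
      rw [ih] at this
      linarith
    · obtain ⟨g, rfl, hg⟩ := exists_minPayoff_cons_eq (P := P) hG e (u ++ p) v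
      have := minPayoff_cons_le (G := G) (P := P) e (u ++ p') g
      rw [ih] at hg
      linarith

theorem minPayoff_iterate_append [Finite EG] (hG : ∀ v, ∃ g, G.src g = v) {y z : List EH} {c : ℤ}
    (h : ∀ v, minPayoff G P (y ++ z) v = minPayoff G P z v + c) (m : ℕ) (v : VG) :
    minPayoff G P ((y ++ ·)^[m] z) v = minPayoff G P z v + m * c := by
  induction m generalizing v with
  | zero => simp
  | succ m ih =>
    rw [Function.iterate_succ_apply', minPayoff_append_eq_add hG ih, h]
    push_cast
    ring

theorem minPayoff_append_le_of_walk [Finite EG] (p : List EH) {q : List EG} {u : List EH} {v w : VG}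
    (hq : q ∈ G.walksFT u.length v w) :
    minPayoff G P (u ++ p) v ≤ payoffSum P q u + minPayoff G P p w := by
  obtain ⟨hl, hw, h0, rfl, rfl⟩ := hq
  induction q generalizing u with
  | nil => exact absurd rfl h0
  | cons g q ih =>
    obtain _ | ⟨e, u⟩ := u
    · simp at hl
    have hle := minPayoff_cons_le (G := G) (P := P) e (u ++ p) g
    simp only [payoffSum, List.zipWith_cons_cons, List.sum_cons, List.head_cons,
      List.cons_append] at *
    obtain _ | ⟨g', q⟩ := q
    · have hu : u = [] := by simpa using hl.symm
      subst hu
      simpa using hle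
    · obtain ⟨hgg, hw'⟩ := List.isChain_cons_cons.1 (isWalkList_iff.1 hw)
      have := ih (by simpa using hl) hw' (by simp)
      rw [List.getLast_cons (by simp)]
      rw [hgg] at hle
      simp only [List.head_cons] at this
      linarith

theorem exists_walk_payoffSum_eq [Finite EG] (hG : ∀ v, ∃ g, G.src g = v) (p : List EH) (v : VG) :
    ∃ q ∈ G.walks p.length, (∀ g ∈ q.head?, G.src g = v) ∧
      payoffSum P q p = minPayoff G P p v := by
  induction p generalizing v with
  | nil => exact ⟨[], ⟨rfl, List.isChain_nil⟩, by simp, rfl⟩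
  | cons e p ih =>
    obtain ⟨g, rfl, hg⟩ := exists_minPayoff_cons_eq (P := P) hG e p v
    obtain ⟨q, ⟨hl, hw⟩, hs, hq⟩ := ih (G.tgt g)
    refine ⟨g :: q, ⟨by simp [hl], List.isChain_cons.2 ⟨fun f hf => (hs f hf).symm, hw⟩⟩,
      by simp, ?_⟩
    rw [hg, ← hq]
    simp [payoffSum]

theorem exists_minPayoff_le_payoffSum [Finite EG] [Nonempty VG] {p : List EH} {q : List EG}
    (hq : q ∈ G.walks p.length) : ∃ v, minPayoff G P p v ≤ payoffSum P q p := by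
  rcases eq_or_ne q [] with rfl | h0
  · obtain ⟨v⟩ := ‹Nonempty VG›
    have hp : p = [] := by simpa using hq.1.symm
    subst hp
    exact ⟨v, le_rfl⟩
  · refine ⟨G.src (q.head h0), ?_⟩
    simpa [minPayoff] using minPayoff_append_le_of_walk (P := P) []
      (⟨hq.1, hq.2, h0, rfl, rfl⟩ : q ∈ G.walksFT p.length (G.src (q.head h0)) _)

variable {B : ℤ}

theorem payoffSum_le (hB : ∀ g e, |P g e| ≤ B) {q : List EG} {p : List EH}
    (h : q.length = p.length) : payoffSum P q p ≤ B * p.length := by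
  induction q generalizing p with
  | nil =>
    have hp : p = [] := by simpa using h.symm
    simp [hp, payoffSum]
  | cons g q ih =>
    obtain _ | ⟨e, p⟩ := p
    · simp at h
    have h1 := ih (p := p) (by simpa using h)
    have h2 := (abs_le.1 (hB g e)).2
    simp only [payoffSum, List.zipWith_cons_cons, List.sum_cons, List.length_cons] at *
    push_cast
    linarith

theorem minPayoff_append_le [Finite EG] (hG : ∀ v, ∃ g, G.src g = v) (hB : ∀ g e, |P g e| ≤ B)
    {p : List EH} {a : ℤ} (h : ∀ v, minPayoff G P p v ≤ a) (u : List EH) (v : VG) :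
    minPayoff G P (u ++ p) v ≤ B * u.length + a := by
  induction u generalizing v with
  | nil => simpa using h v
  | cons e u ih =>
    obtain ⟨g, rfl, hg⟩ := exists_minPayoff_cons_eq (P := P) hG e (u ++ p) v
    rw [List.cons_append, hg, List.length_cons]
    have h1 := ih (G.tgt g)
    have h2 := (abs_le.1 (hB g e)).2
    push_cast
    linarith

theorem le_minPayoff_append [Finite EG] (hG : ∀ v, ∃ g, G.src g = v) (hB : ∀ g e, |P g e| ≤ B)
    {p : List EH} {a : ℤ} (h : ∀ v, a ≤ minPayoff G P p v) (u : List EH) (v : VG) :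
    a - B * u.length ≤ minPayoff G P (u ++ p) v := by
  induction u generalizing v with
  | nil => simpa using h v
  | cons e u ih =>
    obtain ⟨g, rfl, hg⟩ := exists_minPayoff_cons_eq (P := P) hG e (u ++ p) v
    rw [List.cons_append, hg, List.length_cons]
    have h1 := ih (G.tgt g)
    have h2 := (abs_le.1 (hB g e)).1
    push_cast
    linarith

/-- For primitive `G`, the dependence of the least payoff on the starting vertex is bounded
uniformly in the walk played by the opponent. -/
theorem exists_minPayoff_sub_le [Finite VG] [Finite EG] (hG : G.Primitive)
    (hB0 : 0 ≤ B) (hB : ∀ g e, |P g e| ≤ B) :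
    ∃ D : ℤ, ∀ (p : List EH) (v w : VG), minPayoff G P p v ≤ minPayoff G P p w + D := by
  obtain ⟨k, hk⟩ := hG.exists_walksFT_nonempty
  have := hG.nonempty
  have hs := hG.exists_src_eq
  refine ⟨2 * (B * k), fun p v w => ?_⟩
  rcases le_total k p.length with hp | hp
  · obtain ⟨m, hm⟩ := Finite.exists_min (minPayoff G P (p.drop k))
    obtain ⟨q, hq⟩ := hk v m
    have hl : (p.take k).length = k := by simp [hp]
    have h1 := minPayoff_append_le_of_walk (P := P) (p.drop k) (u := p.take k) (by rwa [hl])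
    have h2 := le_minPayoff_append hs hB hm (p.take k) w
    have h3 := payoffSum_le hB (p := p.take k) (hq.1.trans hl.symm)
    rw [hl] at h2 h3
    rw [List.take_append_drop] at h1 h2
    linarith
  · have h1 := minPayoff_append_le (P := P) hs hB (p := []) (a := 0) (fun _ => le_rfl) p v
    have h2 := le_minPayoff_append (P := P) hs hB (p := []) (a := 0) (fun _ => le_rfl) p w
    rw [List.append_nil] at h1 h2
    have h3 : B * (p.length : ℤ) ≤ B * k := by
      gcongr
    linarith

theorem minPayoff_sub_le_sInf_payoffSum [Finite EG] [Nonempty VG] {D : ℤ}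
    (hG : ∀ v, ∃ g, G.src g = v)
    (hD : ∀ (p : List EH) (v w : VG), minPayoff G P p v ≤ minPayoff G P p w + D)
    (p : List EH) (v : VG) :
    minPayoff G P p v - D ≤ sInf ((fun q => payoffSum P q p) '' G.walks p.length) := by
  obtain ⟨q, hq, -⟩ := exists_walk_payoffSum_eq (P := P) hG p v
  refine le_csInf ⟨_, q, hq, rfl⟩ ?_
  rintro _ ⟨q', hq', rfl⟩
  obtain ⟨w, hw⟩ := exists_minPayoff_le_payoffSum (P := P) hq'
  have := hD p v w
  dsimp only
  linarith

theorem sInf_payoffSum_le_minPayoff [Finite EG] (hG : ∀ v, ∃ g, G.src g = v) (p : List EH)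
    (v : VG) : sInf ((fun q => payoffSum P q p) '' G.walks p.length) ≤ minPayoff G P p v := by
  obtain ⟨q, hq, -, h⟩ := exists_walk_payoffSum_eq (P := P) hG p v
  rw [← h]
  exact csInf_le ((finite_walks _).image _).bddBelow ⟨q, hq, rfl⟩

/-- Pigeonhole: every long word contains a block whose removal shifts the least payoff by a
constant and keeps the leading letter. -/
theorem exists_removable_block [Finite VG] [Finite EH] [Nonempty VG] {D : ℤ}
    (hD : ∀ (p : List EH) (v w : VG), minPayoff G P p v ≤ minPayoff G P p w + D) :
    ∃ N : ℕ, ∀ p : List EH, N ≤ p.length → ∃ (x y z : List EH) (c : ℤ), p = x ++ (y ++ z) ∧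
      y ≠ [] ∧ y.length ≤ N ∧ (y ++ z).head? = z.head? ∧
      ∀ v, minPayoff G P (y ++ z) v = minPayoff G P z v + c := by
  obtain ⟨o⟩ := ‹Nonempty VG›
  have hfin : ((univ : Set (Option EH)) ×ˢ
      (univ.pi fun _ : VG => Set.Icc (-D) D)).Finite :=
    finite_univ.prod (Set.Finite.pi fun _ => Set.finite_Icc _ _)
  refine ⟨hfin.toFinset.card, fun p hp => ?_⟩
  set N := hfin.toFinset.card
  obtain ⟨i, hi, j, hj, hij, h⟩ : ∃ i ≤ N, ∃ j ≤ N, i < j ∧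
      ((p.drop i).head?, fun v => minPayoff G P (p.drop i) v - minPayoff G P (p.drop i) o) =
      ((p.drop j).head?, fun v => minPayoff G P (p.drop j) v - minPayoff G P (p.drop j) o) := by
    obtain ⟨i, hi, j, hj, hne, h⟩ := Finset.exists_ne_map_eq_of_card_lt_of_maps_to
      (s := Finset.range (N + 1)) (t := hfin.toFinset)
      (f := fun i => ((p.drop i).head?,
        fun v => minPayoff G P (p.drop i) v - minPayoff G P (p.drop i) o))
      (by simp [N]) (fun i _ => by
        simp only [Finite.coe_toFinset, mem_prod, mem_univ, true_and]
        intro v _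
        have h1 := hD (p.drop i) v o
        have h2 := hD (p.drop i) o v
        constructor <;> linarith)
    simp only [Finset.mem_range] at hi hj
    rcases lt_or_gt_of_ne hne with hlt | hlt
    · exact ⟨i, by omega, j, by omega, hlt, h⟩
    · exact ⟨j, by omega, i, by omega, hlt, h.symm⟩
  have hsplit : (p.drop i).take (j - i) ++ p.drop j = p.drop i := by
    conv_rhs => rw [← List.take_append_drop (j - i) (p.drop i)]
    rw [List.drop_drop]
    congr 3
    omega
  have hlen : ((p.drop i).take (j - i)).length = j - i := by
    simp only [List.length_take, List.length_drop]
    omega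
  refine ⟨p.take i, (p.drop i).take (j - i), p.drop j,
    minPayoff G P (p.drop i) o - minPayoff G P (p.drop j) o, ?_, ?_, ?_, ?_, fun v => ?_⟩
  · rw [hsplit, List.take_append_drop]
  · rw [← List.length_pos_iff_ne_nil, hlen]
    omega
  · omega
  · rw [hsplit]
    exact congrArg Prod.fst h
  · rw [hsplit]
    have := congrFun (congrArg Prod.snd h) v
    dsimp only at this
    linarith

/-- The largest mean payoff of a repeatable block is the growth rate of the least payoff. -/
theorem exists_growth_rate [Finite VG] [Finite EG] [Finite EH] [Nonempty VG] {VH : Type}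
    {H : DirGraph VH EH} (hG : ∀ v, ∃ g, G.src g = v) (hB0 : 0 ≤ B) (hB : ∀ g e, |P g e| ≤ B)
    {D : ℤ} (hD : ∀ (p : List EH) (v w : VG), minPayoff G P p v ≤ minPayoff G P p w + D)
    (hH : ∀ n, (H.walks n).Nonempty) (o : VG) :
    ∃ r C : ℚ, (∀ p, H.IsWalkList p → (minPayoff G P p o : ℚ) ≤ r * p.length + C) ∧
      ∀ n : ℕ, ∃ p ∈ H.walks n, r * n - C ≤ (minPayoff G P p o : ℚ) := by
  obtain ⟨N, hN⟩ := exists_removable_block hD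
  let Q : Set (ℤ × ℕ) := {a | ∃ y z : List EH, y ≠ [] ∧ y.length ≤ N ∧ H.IsWalkList (y ++ z) ∧
    (y ++ z).head? = z.head? ∧ (∀ v, minPayoff G P (y ++ z) v = minPayoff G P z v + a.1) ∧
    y.length = a.2}
  have hbound : ∀ u p : List EH, minPayoff G P (u ++ p) o ≤
      B * u.length + (minPayoff G P p o + D) := fun u p =>
    minPayoff_append_le hG hB (fun v => hD p v o) u o
  have hQfin : Q.Finite := by
    refine ((Set.finite_Icc (-(B * N + D)) (B * N + D)).prod (Set.finite_Iic N)).subset ?_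
    rintro ⟨c, l⟩ ⟨y, z, -, hyN, -, -, hc, rfl⟩
    have h1 := hbound y z
    have h2 := le_minPayoff_append hG hB (p := z) (a := minPayoff G P z o - D)
      (fun v => by linarith [hD z o v]) y o
    have h3 : B * (y.length : ℤ) ≤ B * N := by gcongr
    rw [hc] at h1 h2
    refine ⟨⟨?_, ?_⟩, hyN⟩ <;> dsimp only at * <;> linarith
  have hQne : Q.Nonempty := by
    obtain ⟨p, hp, hw⟩ := hH N
    obtain ⟨x, y, z, c, rfl, h0, hy, hh, hc⟩ := hN p hp.ge
    exact ⟨(c, y.length), y, z, h0, hy, List.IsChain.right_of_append hw, hh, hc, rfl⟩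
  obtain ⟨⟨c, l⟩, ⟨y, z, hy0, hyN, hyz, hhead, hc, hyl⟩, hmax⟩ :=
    Set.exists_max_image Q (fun a => (a.1 : ℚ) / a.2) hQfin hQne
  dsimp only at hc hyl hmax
  set r : ℚ := (c : ℚ) / l with hr
  have hl0 : 0 < l := hyl ▸ List.length_pos_iff_ne_nil.2 hy0
  have hcr : (c : ℚ) = r * l := by
    rw [hr]
    field_simp
  have hrabs := neg_abs_le r
  have hr0 := abs_nonneg r
  have hB0' : (0 : ℚ) ≤ B := by exact_mod_cast hB0
  have hupper : ∀ (n : ℕ) (p : List EH), p.length = n → H.IsWalkList p →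
      (minPayoff G P p o : ℚ) ≤ r * p.length + (B * N + |r| * N) := by
    intro n
    induction n using Nat.strong_induction_on with
    | _ n ih =>
    intro p hpn hp
    rcases le_total N p.length with hle | hle
    · obtain ⟨x, y', z', c', rfl, h0, hy', hh, hc'⟩ := hN p hle
      have hpos := List.length_pos_iff_ne_nil.2 h0
      have hyz' := List.IsChain.right_of_append hp
      have hmean := hmax (c', y'.length) ⟨y', z', h0, hy', hyz', hh, hc', rfl⟩
      dsimp only at hmean
      rw [div_le_iff₀ (by exact_mod_cast hpos)] at hmean
      have hxz : H.IsWalkList (x ++ z') := by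
        obtain ⟨hx, -, hj⟩ := List.isChain_append.1 (isWalkList_iff.1 hp)
        exact List.isChain_append.2 ⟨hx, List.IsChain.right_of_append hyz', hh ▸ hj⟩
      have hrec := ih (x ++ z').length (by simp only [List.length_append] at *; omega) _ rfl hxz
      rw [minPayoff_append_eq_add hG hc']
      simp only [List.length_append] at *
      push_cast at *
      linarith
    · have h1 := minPayoff_append_le (P := P) hG hB (p := []) (a := 0) (fun _ => le_rfl) p o
      rw [List.append_nil, add_zero] at h1
      have h2 : (minPayoff G P p o : ℚ) ≤ B * p.length := by exact_mod_cast h1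
      have h3 : (p.length : ℚ) ≤ N := by exact_mod_cast hle
      nlinarith [mul_le_mul_of_nonneg_left h3 hB0', mul_le_mul_of_nonneg_left h3 hr0,
        mul_le_mul_of_nonneg_right hrabs (Nat.cast_nonneg (α := ℚ) p.length)]
  have hlower : ∀ n : ℕ, ∃ p ∈ H.walks n,
      r * n - (|r| * l + B * (l + z.length) + D - minPayoff G P z o) ≤
        (minPayoff G P p o : ℚ) := by
    intro n
    obtain ⟨k, s, hs, hsl⟩ : ∃ k, ∃ s ≤ l, k * l = n + s := by
      refine ⟨n / l + 1, l - n % l, Nat.sub_le _ _, ?_⟩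
      have h1 := Nat.div_add_mod' n l
      have h2 := Nat.mod_lt n hl0
      rw [add_mul, one_mul]
      omega
    set w := (y ++ ·)^[k] z with hw
    have hwlen : w.length = k * l + z.length := by
      rw [hw]
      clear hsl hw w
      induction k with
      | zero => simp
      | succ k ih =>
        rw [Function.iterate_succ_apply', List.length_append, ih, hyl]
        ring
    have hval := minPayoff_iterate_append hG hc k o
    rw [← hw] at hval
    refine ⟨w.drop (s + z.length), ⟨?_, ?_⟩, ?_⟩
    · rw [List.length_drop]
      omega
    · have := (isWalkList_iterate_append hyz hhead k).1
      rw [← hw, ← List.take_append_drop (s + z.length) w] at this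
      exact List.IsChain.right_of_append this
    · have h1 := hbound (w.take (s + z.length)) (w.drop (s + z.length))
      have h2 : (w.take (s + z.length)).length = s + z.length := by
        rw [List.length_take]
        omega
      rw [List.take_append_drop, h2, hval] at h1
      have h3 : (minPayoff G P z o : ℚ) + (k : ℚ) * c ≤
          B * (s + z.length) + (minPayoff G P (w.drop (s + z.length)) o + D) := by
        exact_mod_cast h1
      have h4 : (k : ℚ) * l = n + s := by exact_mod_cast hsl
      have h5 : (k : ℚ) * c = r * (n + s) := by
        rw [hcr, ← h4]
        ring
      have h6 : (s : ℚ) ≤ l := by exact_mod_cast hs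
      rw [h5] at h3
      nlinarith [mul_le_mul_of_nonneg_left h6 hB0', mul_le_mul_of_nonneg_left h6 hr0,
        mul_le_mul_of_nonneg_right hrabs (Nat.cast_nonneg (α := ℚ) s)]
  refine ⟨r, max (B * N + |r| * N) (|r| * l + B * (l + z.length) + D - minPayoff G P z o),
    fun p hp => (hupper _ p rfl hp).trans (by gcongr; exact le_max_left _ _), fun n => ?_⟩
  obtain ⟨p, hp, h⟩ := hlower n
  exact ⟨p, hp, le_trans (by gcongr; exact le_max_right _ _) h⟩

end MinPayoff

theorem tendsto_div_atTop_of_abs_sub_le {a : ℕ → ℝ} {r C : ℝ} (h : ∀ n, |a n - r * n| ≤ C) :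
    Tendsto (fun n : ℕ => a n / n) atTop (nhds r) := by
  rw [tendsto_iff_norm_sub_tendsto_zero]
  refine squeeze_zero' (Eventually.of_forall fun _ => norm_nonneg _) ?_
    (tendsto_const_div_atTop_nhds_zero_nat C)
  filter_upwards [eventually_gt_atTop 0] with n hn
  have hn' : (0 : ℝ) < n := by exact_mod_cast hn
  have heq : a n / n - r = (a n - r * n) / n := by
    field_simp
  rw [heq, Real.norm_eq_abs, abs_div, abs_of_pos hn']
  gcongr
  exact h n

/-- For primitive graphs `G, H` and a payoff function `P`, the limit
`V(G,H,P) = lim (1/n) V_n(G,H,P)` exists and is a rational number. -/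
theorem game_value_rational {VG EG VH EH : Type} [Fintype VG] [Fintype EG]
    [Fintype VH] [Fintype EH] (G : DirGraph VG EG) (H : DirGraph VH EH)
    (hG : G.Primitive) (hH : H.Primitive) (P : EG → EH → ℤ) :
    ∃ r : ℚ, Filter.Tendsto (fun n : ℕ => (Vn G H P n : ℝ) / n)
      Filter.atTop (nhds (r : ℝ)) := by
  have := hG.nonempty
  have hGs := hG.exists_src_eq
  obtain ⟨o⟩ := hG.nonempty
  obtain ⟨o'⟩ := hH.nonempty
  have hHne : ∀ n, (H.walks n).Nonempty := fun n =>
    (DirGraph.exists_walk_from hH.exists_src_eq n o').imp fun _ h => h.1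
  obtain ⟨B, hB0, hB⟩ : ∃ B : ℤ, 0 ≤ B ∧ ∀ g e, |P g e| ≤ B := by
    refine ⟨∑ g, ∑ e, |P g e|, by positivity, fun g e => ?_⟩
    exact (Finset.single_le_sum (f := fun e => |P g e|) (fun _ _ => abs_nonneg _)
      (Finset.mem_univ e)).trans (Finset.single_le_sum (f := fun g => ∑ e, |P g e|)
        (fun _ _ => by positivity) (Finset.mem_univ g))
  obtain ⟨D, hD⟩ := exists_minPayoff_sub_le (P := P) hG hB0 hB
  obtain ⟨r, C, hupper, hlower⟩ := exists_growth_rate hGs hB0 hB hD hHne o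
  have hD0 : (0 : ℚ) ≤ D := by
    have := hD [] o o
    exact_mod_cast (by linarith : (0 : ℤ) ≤ D)
  have hV : ∀ n : ℕ, |(Vn G H P n : ℚ) - r * n| ≤ C + D := by
    intro n
    have hfin := (H.finite_walks n).image
      fun p => sInf ((fun q => payoffSum P q p) '' G.walks n)
    rw [abs_le]
    constructor
    · obtain ⟨p, hp, h⟩ := hlower n
      have h1 := minPayoff_sub_le_sInf_payoffSum hGs hD p o
      rw [hp.1] at h1
      have h2 : minPayoff G P p o - D ≤ Vn G H P n :=
        h1.trans (le_csSup hfin.bddAbove ⟨p, hp, rfl⟩)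
      have h3 : (minPayoff G P p o : ℚ) - D ≤ Vn G H P n := by exact_mod_cast h2
      linarith
    · obtain ⟨p, hp, h⟩ := ((hHne n).image
        fun p => sInf ((fun q => payoffSum P q p) '' G.walks n)).csSup_mem hfin
      have h1 := sInf_payoffSum_le_minPayoff (P := P) hGs p o
      rw [hp.1] at h1
      have h2 : Vn G H P n ≤ minPayoff G P p o := h.symm.trans_le h1
      have h3 : (Vn G H P n : ℚ) ≤ minPayoff G P p o := by exact_mod_cast h2
      have h4 := hupper p hp.2
      rw [hp.1] at h4
      linarith
  refine ⟨r, tendsto_div_atTop_of_abs_sub_le (C := ((C + D : ℚ) : ℝ)) fun n => ?_⟩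
  exact_mod_cast hV n
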